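/- arXiv:2409.20216 — 3 statements merged into one kernel-verified Lean document; each statement's English description precedes it below -/
import Mathlib

section
/- Let 0 < c ≤ 1 and let g ∈ C(q_c). Then the pre-Schwarzian norm of g satisfies ||P_g|| ≤ (1 − α²)(1 − √(1 − cα))/α, where α is the unique root in (0,1) of the equation 2(1 + r²)(1 − √(1 − cr)) − c(r + 3r³) = 0. -/
open Metric Set

noncomputable section

/-- The open unit disk in the complex plane. -/
def unitDisk : Set ℂ := Metric.ball 0 1

/-- A function is normalized if it is analytic on the unit disk with f(0)=0 and f'(0)=1. -/
def IsNormalized (f : ℂ → ℂ) : Prop :=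
  AnalyticOnNhd ℂ f unitDisk ∧ f 0 = 0 ∧ deriv f 0 = 1

/-- Subordination: f ≺ g on the unit disk. -/
def Subord (f g : ℂ → ℂ) : Prop :=
  ∃ ω : ℂ → ℂ, AnalyticOnNhd ℂ ω unitDisk ∧ ω 0 = 0 ∧
    Set.MapsTo ω unitDisk unitDisk ∧ Set.EqOn f (g ∘ ω) unitDisk

/-- The quantity z f'(z)/f(z), extended by its analytic value 1 at z = 0. -/
def sratio (f : ℂ → ℂ) (z : ℂ) : ℂ := if z = 0 then 1 else z * deriv f z / f z

/-- The Ma-Minda starlike class S*(φ). -/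
def MemSstar (φ f : ℂ → ℂ) : Prop :=
  IsNormalized f ∧ (∀ z ∈ unitDisk, z ≠ 0 → f z ≠ 0) ∧ Subord (sratio f) φ

/-- The Ma-Minda convex class C(φ). -/
def MemC (φ g : ℂ → ℂ) : Prop :=
  IsNormalized g ∧ (∀ z ∈ unitDisk, deriv g z ≠ 0) ∧
    Subord (fun z => 1 + z * deriv (deriv g) z / deriv g z) φ

/-- The set of values (1-|z|²)|P_f(z)|, z ∈ 𝔻, whose supremum is the pre-Schwarzian norm. -/
def pSVals (f : ℂ → ℂ) : Set ℝ :=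
  {x : ℝ | ∃ z ∈ unitDisk, x = (1 - ‖z‖^2) * ‖deriv (deriv f) z / deriv f z‖}

/-- Among all points of a circle of radius `‖w‖ < 1`, the distance of `√(1 + w)` to `1` is largest
at the negative real point. -/
lemma norm_sub_one_le_of_sq_eq {u w : ℂ} (hre : 0 ≤ u.re) (hu : u ^ 2 = 1 + w) (hw : ‖w‖ < 1) :
    ‖u - 1‖ ≤ 1 - √(1 - ‖w‖) := by
  have hprod : ‖u - 1‖ * ‖u + 1‖ = ‖w‖ := by
    rw [← norm_mul]
    congr 1
    linear_combination hu
  have h_one : 1 ≤ ‖u + 1‖ := by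
    have := Complex.re_le_norm (u + 1)
    simp only [Complex.add_re, Complex.one_re] at this
    linarith
  have h_two : 2 ≤ ‖u + 1‖ + ‖u - 1‖ := by
    have := norm_sub_le (u + 1) (u - 1)
    have h : ‖u + 1 - (u - 1)‖ = 2 := by
      rw [show u + 1 - (u - 1) = 2 by ring]
      norm_num
    linarith
  have h_le : ‖u - 1‖ ≤ 1 := by nlinarith [norm_nonneg (u - 1)]
  have : √(1 - ‖w‖) ≤ 1 - ‖u - 1‖ := by
    apply Real.sqrt_le_iff.mpr
    constructor
    · linarith
    · nlinarith [norm_nonneg (u - 1)]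
  linarith

lemma norm_cpow_half_sub_one_le {w : ℂ} (hw : ‖w‖ < 1) :
    ‖(1 + w) ^ ((1 : ℂ) / 2) - 1‖ ≤ 1 - √(1 - ‖w‖) := by
  rw [one_div]
  refine norm_sub_one_le_of_sq_eq ?_ ?_ hw
  · rw [Complex.cpow_inv_two_re]
    positivity
  · exact Complex.cpow_ofNat_inv_pow _ 2

/-- A root `α` of the critical point equation maximizes `(1 - r²)(1 - √(1 - cr)) / r`. -/
lemma one_sub_sq_mul_one_sub_sqrt_div_le {c α r : ℝ} (hc₀ : 0 < c) (hc₁ : c ≤ 1)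
    (hα : α ∈ Ioo (0 : ℝ) 1)
    (hroot : 2 * (1 + α ^ 2) * (1 - √(1 - c * α)) - c * (α + 3 * α ^ 3) = 0)
    (hr : r ∈ Ioo (0 : ℝ) 1) :
    (1 - r ^ 2) * (1 - √(1 - c * r)) / r ≤ (1 - α ^ 2) * (1 - √(1 - c * α)) / α := by
  obtain ⟨hα₀, hα₁⟩ := hα
  obtain ⟨hr₀, hr₁⟩ := hr
  have hs₀ := Real.sqrt_nonneg (1 - c * r)
  have hs := Real.sq_sqrt (show 0 ≤ 1 - c * r by nlinarith)
  have ht₀ := Real.sqrt_nonneg (1 - c * α)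
  have ht := Real.sq_sqrt (show 0 ≤ 1 - c * α by nlinarith)
  set s := √(1 - c * r)
  set t := √(1 - c * α)
  have ht₁ : t < 1 := by nlinarith [mul_pos hc₀ hα₀]
  have hcrit : (1 + 3 * t) * α ^ 2 = 1 - t := by
    refine mul_left_cancel₀ (sub_pos.mpr ht₁).ne' ?_
    linear_combination -hroot - (1 + 3 * α ^ 2) * ht
  have htpos : 0 < t := by nlinarith
  have hcsq : (1 - t) * ((1 + t) ^ 2 * (1 + 3 * t)) = c ^ 2 := by
    refine mul_left_cancel₀ (sub_pos.mpr ht₁).ne' ?_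
    have h : (1 - t ^ 2) ^ 2 = (c * α) ^ 2 := by rw [ht]; ring
    linear_combination (1 + 3 * t) * h + c ^ 2 * hcrit
  have ht_large : 2 ≤ 3 * t ^ 2 := by
    have hcle : c ^ 2 ≤ 1 := by nlinarith
    have h : 0 ≤ t * (3 * t ^ 3 + 4 * t ^ 2 - 2 * t - 4) := by nlinarith
    have h' : 0 ≤ 3 * t ^ 3 + 4 * t ^ 2 - 2 * t - 4 := nonneg_of_mul_nonneg_right h htpos
    by_contra! hlt
    nlinarith
  have hquad : 0 ≤ (s - t) ^ 2 * (s ^ 2 + 2 * t * s + 3 * t ^ 2 - 2) := by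
    apply mul_nonneg (sq_nonneg _)
    nlinarith [mul_nonneg ht₀ hs₀]
  have hα_sq : 1 - α ^ 2 = 4 * t / (1 + 3 * t) := by
    field_simp
    linear_combination -hcrit
  have hr_sq : r ^ 2 = (1 - s ^ 2) ^ 2 / ((1 - t) * ((1 + t) ^ 2 * (1 + 3 * t))) := by
    rw [hcsq, hs]
    field_simp
    ring
  have hmain : (1 - r ^ 2) / (1 + s) ≤ (1 - α ^ 2) / (1 + t) := by
    have ht' : 0 < 1 - t := sub_pos.mpr ht₁
    rw [hα_sq, hr_sq, div_le_div_iff₀ (by positivity) (by positivity), ← sub_nonneg]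
    have : 4 * t / (1 + 3 * t) * (1 + s) -
        (1 - (1 - s ^ 2) ^ 2 / ((1 - t) * ((1 + t) ^ 2 * (1 + 3 * t)))) * (1 + t) =
        (s - t) ^ 2 * (s ^ 2 + 2 * t * s + 3 * t ^ 2 - 2) / ((1 - t) * (1 + t) * (1 + 3 * t)) := by
      field_simp
      ring
    rw [this]
    positivity
  have hr_div : (1 - s) / r = c / (1 + s) := by
    rw [div_eq_div_iff hr₀.ne' (by positivity)]
    linear_combination -hs
  have hα_div : (1 - t) / α = c / (1 + t) := by
    rw [div_eq_div_iff hα₀.ne' (by positivity)]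
    linear_combination -ht
  rw [mul_div_assoc, mul_div_assoc, hr_div, hα_div]
  calc (1 - r ^ 2) * (c / (1 + s)) = c * ((1 - r ^ 2) / (1 + s)) := by ring
    _ ≤ c * ((1 - α ^ 2) / (1 + t)) := by gcongr
    _ = (1 - α ^ 2) * (c / (1 + t)) := by ring

/-- Pointwise bound for the pre-Schwarzian derivative away from the origin. -/
lemma MemC.norm_preSchwarzian_le {c : ℝ} (hc₀ : 0 < c) (hc₁ : c ≤ 1) {g : ℂ → ℂ}
    (hg : MemC (fun z => (1 + (c : ℂ) * z) ^ ((1 : ℂ) / 2)) g) {z : ℂ} (hz : z ∈ unitDisk)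
    (hz₀ : z ≠ 0) :
    ‖deriv (deriv g) z / deriv g z‖ ≤ (1 - √(1 - c * ‖z‖)) / ‖z‖ := by
  obtain ⟨-, -, ω, hω, hω₀, hmaps, heq⟩ := hg
  have hz₁ : ‖z‖ < 1 := by simpa [unitDisk] using hz
  have hschwarz : ‖ω z‖ ≤ ‖z‖ :=
    Complex.norm_le_norm_of_mapsTo_ball hω.differentiableOn
      (hmaps.mono_right ball_subset_closedBall) hω₀ hz₁
  have hnorm : ‖(c : ℂ) * ω z‖ = c * ‖ω z‖ := by
    rw [norm_mul, Complex.norm_of_nonneg hc₀.le]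
  have hle : c * ‖ω z‖ ≤ c * ‖z‖ := by gcongr
  have hlt : ‖(c : ℂ) * ω z‖ < 1 := by
    rw [hnorm]
    nlinarith [norm_nonneg z]
  have hval : z * (deriv (deriv g) z / deriv g z) =
      (1 + (c : ℂ) * ω z) ^ ((1 : ℂ) / 2) - 1 := by
    have := heq hz
    simp only [Function.comp_apply] at this
    rw [← this]
    ring
  rw [le_div_iff₀ (norm_pos_iff.mpr hz₀), mul_comm, ← norm_mul, hval]
  refine (norm_cpow_half_sub_one_le hlt).trans ?_
  rw [hnorm]
  gcongr

/-- Pre-Schwarzian norm estimate for the class C(q_c). -/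
theorem preSchwarzian_bound_C_qc (c : ℝ) (hc₀ : 0 < c) (hc₁ : c ≤ 1)
    (g : ℂ → ℂ) (hg : MemC (fun z => (1 + (c:ℂ) * z) ^ ((1:ℂ)/2)) g)
    (α : ℝ) (hα : α ∈ Set.Ioo (0:ℝ) 1)
    (hroot : 2*(1 + α^2)*(1 - Real.sqrt (1 - c*α)) - c*(α + 3*α^3) = 0) :
    ∀ z ∈ unitDisk, (1 - ‖z‖^2) * ‖deriv (deriv g) z / deriv g z‖ ≤
      (1 - α^2) * (1 - Real.sqrt (1 - c*α)) / α := by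
  set M := (1 - α ^ 2) * (1 - √(1 - c * α)) / α
  have hpunct : ∀ z ∈ unitDisk, z ≠ 0 →
      (1 - ‖z‖ ^ 2) * ‖deriv (deriv g) z / deriv g z‖ ≤ M := by
    intro z hz hz₀
    have hz₁ : ‖z‖ < 1 := by simpa [unitDisk] using hz
    have hzpos : 0 < ‖z‖ := norm_pos_iff.mpr hz₀
    calc (1 - ‖z‖ ^ 2) * ‖deriv (deriv g) z / deriv g z‖
        ≤ (1 - ‖z‖ ^ 2) * ((1 - √(1 - c * ‖z‖)) / ‖z‖) := by
          apply mul_le_mul_of_nonneg_left (hg.norm_preSchwarzian_le hc₀ hc₁ hz hz₀)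
          nlinarith
      _ = (1 - ‖z‖ ^ 2) * (1 - √(1 - c * ‖z‖)) / ‖z‖ := by rw [mul_div_assoc]
      _ ≤ M := one_sub_sq_mul_one_sub_sqrt_div_le hc₀ hc₁ hα hroot ⟨hzpos, hz₁⟩
  intro z hz
  rcases eq_or_ne z 0 with rfl | hz₀
  · obtain ⟨⟨hana, -, -⟩, hne, -⟩ := hg
    have hcont : ContinuousAt
        (fun z : ℂ => (1 - ‖z‖ ^ 2) * ‖deriv (deriv g) z / deriv g z‖) 0 := by
      have h₁ := (hana 0 hz).deriv.continuousAt
      have h₂ := (hana 0 hz).deriv.deriv.continuousAt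
      exact (by fun_prop : ContinuousAt (fun z : ℂ => 1 - ‖z‖ ^ 2) 0).mul
        (h₂.div h₁ (hne 0 hz)).norm
    refine le_of_tendsto (hcont.tendsto.mono_left (nhdsWithin_le_nhds (s := {0}ᶜ))) ?_
    filter_upwards [self_mem_nhdsWithin,
      nhdsWithin_le_nhds (isOpen_ball.mem_nhds hz)] with w hw₀ hw
    exact hpunct w hw hw₀
  · exact hpunct z hz hz₀
end
end

section
/- Let 0 < c ≤ 1, let f ∈ S*(q_c), and let J[f](z) = ∫₀^z f(t)/t dt be the Alexander transform of f. Then the pre-Schwarzian norm of J[f] satisfies ||P_{J[f]}|| ≤ (1 − α²)(1 − √(1 − cα))/α, where α is the unique root in (0,1) of the equation 2(1 + r²)(1 − √(1 − cr)) − c(r + 3r³) = 0. -/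
open Metric Set

noncomputable section

/-- The Alexander transform J[f](z) = ∫₀^z f(t)/t dt (along the segment from 0 to z),
where f(t)/t is extended by its value 1 at t = 0. -/
def alexander (f : ℂ → ℂ) (z : ℂ) : ℂ :=
  z * ∫ s in (0:ℝ)..1, (if (s:ℂ) * z = 0 then 1 else f ((s:ℂ) * z) / ((s:ℂ) * z))

/-- Distance of the principal square root of `1 + w` from `1`, for `w` in the unit disk. -/
lemma norm_cpow_half_one_add_sub_one_le {w : ℂ} {ρ : ℝ} (hw : ‖w‖ ≤ ρ) (hρ : ρ < 1) :
    ‖(1 + w) ^ ((1 : ℂ) / 2) - 1‖ ≤ 1 - √(1 - ρ) := by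
  rw [one_div]
  set u : ℂ := (1 + w) ^ ((2 : ℂ)⁻¹) with hu
  have hsq : u ^ 2 = 1 + w := Complex.cpow_ofNat_inv_pow _ 2
  have hre : 0 ≤ u.re := by rw [hu, Complex.cpow_inv_two_re]; positivity
  have hprod : ‖u - 1‖ * ‖u + 1‖ = ‖w‖ := by
    rw [← norm_mul]; congr 1; linear_combination hsq
  have h1 : 1 ≤ ‖u + 1‖ := by
    have := Complex.re_le_norm (u + 1)
    simp only [Complex.add_re, Complex.one_re] at this
    linarith
  have h2 : 2 ≤ ‖u + 1‖ + ‖u - 1‖ := by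
    have := norm_sub_le (u + 1) (u - 1)
    rw [show u + 1 - (u - 1) = 2 by ring] at this
    simpa using this
  have hd0 := norm_nonneg (u - 1)
  have hd : ‖u - 1‖ ≤ 1 := by nlinarith
  have : √(1 - ρ) ≤ 1 - ‖u - 1‖ := by
    rw [Real.sqrt_le_left (by linarith)]
    nlinarith
  linarith

/-- On the unit disk, the Alexander transform is a primitive of `f(t)/t`. -/
lemma hasDerivAt_alexander {f : ℂ → ℂ} (hf : IsNormalized f) {z : ℂ} (hz : z ∈ unitDisk) :
    HasDerivAt (alexander f) (dslope f 0 z) z := by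
  obtain ⟨hfa, hf0, hf1⟩ := hf
  have hdiff : DifferentiableOn ℂ (dslope f 0) (ball 0 1) :=
    (Complex.differentiableOn_dslope (ball_mem_nhds _ one_pos)).2 hfa.differentiableOn
  obtain ⟨G, hG⟩ := hdiff.isExactOn_ball
  have heq : ∀ w ∈ unitDisk, alexander f w = G w - G 0 := by
    intro w hw
    have hmem : ∀ s ∈ uIcc (0 : ℝ) 1, (s : ℂ) * w ∈ ball (0 : ℂ) 1 := by
      intro s hs
      rw [uIcc_of_le zero_le_one] at hs
      have hw' : ‖w‖ < 1 := by simpa [unitDisk] using hw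
      rw [mem_ball_zero_iff, norm_mul, Complex.norm_real, Real.norm_of_nonneg hs.1]
      nlinarith [hs.1, hs.2, norm_nonneg w]
    have hint : (fun s : ℝ ↦ if (s : ℂ) * w = 0 then 1 else f ((s : ℂ) * w) / ((s : ℂ) * w))
        = fun s : ℝ ↦ dslope f 0 (s * w) := by
      funext s
      split_ifs with h
      · rw [h, dslope_same, hf1]
      · rw [dslope_of_ne _ h, slope_def_field, hf0, sub_zero, sub_zero]
    rw [alexander, hint, ← intervalIntegral.integral_const_mul]
    have hderiv : ∀ s ∈ uIcc (0 : ℝ) 1,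
        HasDerivAt (fun s : ℝ ↦ G (s * w)) (w * dslope f 0 (s * w)) s := by
      intro s hs
      have h1 : HasDerivAt (fun t : ℂ ↦ t * w) w (s : ℂ) := by
        simpa using (hasDerivAt_id (s : ℂ)).mul_const w
      have h2 := (HasDerivAt.comp (s : ℂ) (hG _ (hmem s hs)) h1).comp_ofReal
      rw [mul_comm]
      exact h2
    rw [intervalIntegral.integral_eq_sub_of_hasDerivAt hderiv]
    · simp
    · apply ContinuousOn.intervalIntegrable
      exact continuousOn_const.mul (hdiff.continuousOn.comp (by fun_prop) hmem)
  refine ((hG z hz).sub_const (G 0)).congr_of_eventuallyEq ?_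
  filter_upwards [isOpen_ball.mem_nhds hz] with w hw using heq w hw

/-- Pre-Schwarzian norm estimate for the Alexander transform of functions in S*(q_c). -/
theorem preSchwarzian_bound_alexander_Sstar_qc (c : ℝ) (hc₀ : 0 < c) (hc₁ : c ≤ 1)
    (f : ℂ → ℂ) (hf : MemSstar (fun z => (1 + (c:ℂ) * z) ^ ((1:ℂ)/2)) f)
    (α : ℝ) (hα : α ∈ Set.Ioo (0:ℝ) 1)
    (hroot : 2*(1 + α^2)*(1 - Real.sqrt (1 - c*α)) - c*(α + 3*α^3) = 0) :
    ∀ z ∈ unitDisk, (1 - ‖z‖^2) *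
        ‖deriv (deriv (alexander f)) z / deriv (alexander f) z‖ ≤
      (1 - α^2) * (1 - Real.sqrt (1 - c*α)) / α := by
  have hN := hf.1
  obtain ⟨⟨hfa, hf0, hf1⟩, hfne, ω, hωa, hω0, hωm, hωe⟩ := hf
  have hdiff : DifferentiableOn ℂ (dslope f 0) (ball 0 1) :=
    (Complex.differentiableOn_dslope (ball_mem_nhds _ one_pos)).2 hfa.differentiableOn
  have hD : ∀ z ∈ unitDisk, deriv (alexander f) z = dslope f 0 z :=
    fun z hz ↦ (hasDerivAt_alexander hN hz).deriv
  have hDD : ∀ z ∈ unitDisk, deriv (deriv (alexander f)) z = deriv (dslope f 0) z := by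
    intro z hz
    refine Filter.EventuallyEq.deriv_eq ?_
    filter_upwards [isOpen_ball.mem_nhds hz] with w hw using hD w hw
  have hne : ∀ z ∈ unitDisk, z ≠ 0 →
      (1 - ‖z‖ ^ 2) * ‖deriv (dslope f 0) z / dslope f 0 z‖ ≤
        (1 - α ^ 2) * (1 - √(1 - c * α)) / α := by
    intro z hz hz0
    have hz1 : ‖z‖ < 1 := by simpa [unitDisk] using hz
    have hzpos : 0 < ‖z‖ := norm_pos_iff.2 hz0
    have hfz := hfne z hz hz0
    have hslope : dslope f 0 =ᶠ[nhds z] fun w ↦ f w / w := by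
      filter_upwards [isOpen_ne.mem_nhds hz0] with w hw
      rw [dslope_of_ne _ hw, slope_def_field, hf0, sub_zero, sub_zero]
    have hquot : deriv (dslope f 0) z / dslope f 0 z = (sratio f z - 1) / z := by
      have hd := ((hfa z hz).differentiableAt.hasDerivAt.div (hasDerivAt_id z) hz0).deriv
      rw [hslope.deriv_eq, hslope.eq_of_nhds, sratio, if_neg hz0]
      change deriv (fun w ↦ f w / w) z = _ at hd
      rw [hd]
      simp only [id]
      field_simp
    have hω : ‖ω z‖ ≤ ‖z‖ :=
      Complex.norm_le_norm_of_mapsTo_ball hωa.differentiableOn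
        (hωm.mono_right ball_subset_closedBall) hω0 hz1
    have hroot_le : ‖sratio f z - 1‖ ≤ 1 - √(1 - c * ‖z‖) := by
      rw [hωe hz]
      refine norm_cpow_half_one_add_sub_one_le ?_ (by nlinarith)
      rw [norm_mul, Complex.norm_real, Real.norm_of_nonneg hc₀.le]
      gcongr
    refine le_trans ?_ (one_sub_sq_mul_one_sub_sqrt_div_le hc₀ hc₁ hα hroot ⟨hzpos, hz1⟩)
    rw [hquot, norm_div, mul_div_assoc]
    have : 0 ≤ 1 - ‖z‖ ^ 2 := by nlinarith
    gcongr
  intro z hz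
  rw [hDD z hz, hD z hz]
  rcases ne_or_eq z 0 with hz0 | rfl
  · exact hne z hz hz0
  have hcont : ContinuousAt
      (fun w : ℂ ↦ (1 - ‖w‖ ^ 2) * ‖deriv (dslope f 0) w / dslope f 0 w‖) 0 := by
    have ha := hdiff.analyticAt (ball_mem_nhds (0 : ℂ) one_pos)
    have h0 : dslope f 0 0 ≠ 0 := by simp [hf1]
    exact (by fun_prop : ContinuousAt (fun w : ℂ ↦ 1 - ‖w‖ ^ 2) 0).mul
      (ha.deriv.continuousAt.div ha.continuousAt h0).norm
  refine le_of_tendsto (x := nhdsWithin (0 : ℂ) {0}ᶜ)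
    (hcont.tendsto.mono_left nhdsWithin_le_nhds) ?_
  filter_upwards [self_mem_nhdsWithin, mem_nhdsWithin_of_mem_nhds (isOpen_ball.mem_nhds hz)]
    with w hw0 hw using hne w hw hw0
end
end

section
/- Let 0 < c ≤ 1 and let f₄(z) = ∫₀^z exp(∫₀^u (√(1 − ct) − 1)/t dt) du. Then f₄ ∈ C(q_c) and its pre-Schwarzian norm satisfies ||P_{f₄}|| = (1 − α²)(1 − √(1 − cα))/α, where α is the unique root in (0,1) of the equation 2(1 + r²)(1 − √(1 − cr)) − c(r + 3r³) = 0. In particular, the bound of the norm estimate for C(q_c) is sharp. -/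
open Metric Set

noncomputable section

/-- The integrand (√(1 − ct) − 1)/t, extended by its analytic value −c/2 at t = 0,
where √ is the principal branch of the square root. -/
def sqrtIntegrand (c : ℝ) (t : ℂ) : ℂ :=
  if t = 0 then -((c:ℂ)/2) else ((1 - (c:ℂ) * t) ^ ((1:ℂ)/2) - 1) / t

/-- The inner integral ∫₀^u (√(1 − ct) − 1)/t dt along the segment from 0 to u. -/
def innerSqrtIntegral (c : ℝ) (u : ℂ) : ℂ :=
  u * ∫ s in (0:ℝ)..1, sqrtIntegrand c ((s:ℂ) * u)

/-- The extremal function f₄(z) = ∫₀^z exp(∫₀^u (√(1 − ct) − 1)/t dt) du, all integrals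
being taken along segments from 0. -/
def extremalCQc (c : ℝ) (z : ℂ) : ℂ :=
  z * ∫ s in (0:ℝ)..1, Complex.exp (innerSqrtIntegral c ((s:ℂ) * z))

/-- The integral of a holomorphic function along segments from the centre of the unit disk
is a primitive of it. -/
theorem hasDerivAt_segment_integral {f : ℂ → ℂ} (hf : DifferentiableOn ℂ f (ball 0 1))
    {z : ℂ} (hz : z ∈ ball (0 : ℂ) 1) :
    HasDerivAt (fun u => u * ∫ s in (0:ℝ)..1, f ((s:ℂ) * u)) (f z) z := by
  obtain ⟨F, hF⟩ := hf.isExactOn_ball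
  have key : ∀ u ∈ ball (0 : ℂ) 1, u * ∫ s in (0:ℝ)..1, f ((s:ℂ) * u) = F u - F 0 := by
    intro u hu
    have hmem : ∀ s ∈ Set.uIcc (0:ℝ) 1, (s:ℂ) * u ∈ ball (0 : ℂ) 1 := by
      intro s hs
      rw [Set.uIcc_of_le zero_le_one] at hs
      rw [mem_ball_zero_iff] at hu ⊢
      rw [norm_mul, Complex.norm_real, Real.norm_of_nonneg hs.1]
      nlinarith [hs.1, hs.2, norm_nonneg u]
    have hderiv : ∀ s ∈ Set.uIcc (0:ℝ) 1,
        HasDerivAt (fun s : ℝ => F ((s:ℂ) * u)) (u * f ((s:ℂ) * u)) s := by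
      intro s hs
      have h := (hF _ (hmem s hs)).comp (s:ℂ) ((hasDerivAt_id (s:ℂ)).mul_const u)
      simpa [Function.comp_def, mul_comm] using h.comp_ofReal
    have hcont : ContinuousOn (fun s : ℝ => u * f ((s:ℂ) * u)) (Set.uIcc (0:ℝ) 1) :=
      continuousOn_const.mul (hf.continuousOn.comp (by fun_prop) hmem)
    rw [← intervalIntegral.integral_const_mul,
      intervalIntegral.integral_eq_sub_of_hasDerivAt hderiv hcont.intervalIntegrable]
    simp
  refine ((hF z hz).sub_const (F 0)).congr_of_eventuallyEq ?_
  filter_upwards [isOpen_ball.mem_nhds hz] with u hu using key u hu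

theorem cpow_half_sq (w : ℂ) : (w ^ ((1:ℂ)/2)) ^ 2 = w := by
  rw [one_div]
  exact Complex.cpow_ofNat_inv_pow w 2

theorem cpow_half_re (w : ℂ) : (w ^ ((1:ℂ)/2)).re = √((‖w‖ + w.re) / 2) := by
  rw [one_div]
  exact Complex.cpow_inv_two_re w

theorem one_add_cpow_half_ne_zero (w : ℂ) : 1 + w ^ ((1:ℂ)/2) ≠ 0 := by
  intro h
  have h1 := congrArg Complex.re h
  rw [Complex.add_re, cpow_half_re, Complex.one_re, Complex.zero_re] at h1
  linarith [Real.sqrt_nonneg ((‖w‖ + w.re) / 2)]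

theorem sqrtIntegrand_eq (c : ℝ) (t : ℂ) :
    sqrtIntegrand c t = -c / (1 + (1 - (c:ℂ) * t) ^ ((1:ℂ)/2)) := by
  have h2 := cpow_half_sq (1 - (c:ℂ) * t)
  have h0 := one_add_cpow_half_ne_zero (1 - (c:ℂ) * t)
  unfold sqrtIntegrand
  split_ifs with ht
  · subst ht
    norm_num [neg_div]
  · rw [div_eq_div_iff ht h0]
    linear_combination h2

theorem one_sub_mul_mem_slitPlane {c : ℝ} (hc₀ : 0 < c) (hc₁ : c ≤ 1) {t : ℂ}
    (ht : t ∈ unitDisk) : 1 - (c:ℂ) * t ∈ Complex.slitPlane := by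
  left
  have h1 : ‖t‖ < 1 := by simpa [unitDisk] using ht
  have h2 := Complex.re_le_norm t
  simp only [Complex.sub_re, Complex.one_re, Complex.re_ofReal_mul]
  nlinarith

theorem differentiableOn_sqrtIntegrand {c : ℝ} (hc₀ : 0 < c) (hc₁ : c ≤ 1) :
    DifferentiableOn ℂ (sqrtIntegrand c) unitDisk := by
  rw [funext (sqrtIntegrand_eq c)]
  refine (differentiableOn_const _).div ?_ fun t _ => one_add_cpow_half_ne_zero _
  refine (differentiableOn_const _).add (DifferentiableOn.cpow_const (by fun_prop) ?_)
  exact fun t ht => one_sub_mul_mem_slitPlane hc₀ hc₁ ht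

theorem hasDerivAt_innerSqrtIntegral {c : ℝ} (hc₀ : 0 < c) (hc₁ : c ≤ 1) {z : ℂ}
    (hz : z ∈ unitDisk) : HasDerivAt (innerSqrtIntegral c) (sqrtIntegrand c z) z :=
  hasDerivAt_segment_integral (differentiableOn_sqrtIntegrand hc₀ hc₁) hz

theorem hasDerivAt_extremalCQc {c : ℝ} (hc₀ : 0 < c) (hc₁ : c ≤ 1) {z : ℂ}
    (hz : z ∈ unitDisk) :
    HasDerivAt (extremalCQc c) (Complex.exp (innerSqrtIntegral c z)) z := by
  refine hasDerivAt_segment_integral (f := fun u => Complex.exp (innerSqrtIntegral c u)) ?_ hz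
  exact fun w hw =>
    (hasDerivAt_innerSqrtIntegral hc₀ hc₁ hw).cexp.differentiableAt.differentiableWithinAt

theorem hasDerivAt_deriv_extremalCQc {c : ℝ} (hc₀ : 0 < c) (hc₁ : c ≤ 1) {z : ℂ}
    (hz : z ∈ unitDisk) :
    HasDerivAt (deriv (extremalCQc c))
      (Complex.exp (innerSqrtIntegral c z) * sqrtIntegrand c z) z := by
  refine (hasDerivAt_innerSqrtIntegral hc₀ hc₁ hz).cexp.congr_of_eventuallyEq ?_
  filter_upwards [isOpen_ball.mem_nhds hz] with u hu using (hasDerivAt_extremalCQc hc₀ hc₁ hu).deriv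

theorem preSchwarzian_extremalCQc {c : ℝ} (hc₀ : 0 < c) (hc₁ : c ≤ 1) {z : ℂ}
    (hz : z ∈ unitDisk) :
    deriv (deriv (extremalCQc c)) z / deriv (extremalCQc c) z = sqrtIntegrand c z := by
  rw [(hasDerivAt_deriv_extremalCQc hc₀ hc₁ hz).deriv, (hasDerivAt_extremalCQc hc₀ hc₁ hz).deriv,
    mul_div_cancel_left₀ _ (Complex.exp_ne_zero _)]

theorem memC_extremalCQc {c : ℝ} (hc₀ : 0 < c) (hc₁ : c ≤ 1) :
    MemC (fun z => (1 + (c:ℂ) * z) ^ ((1:ℂ)/2)) (extremalCQc c) := by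
  have h0 : (0:ℂ) ∈ unitDisk := mem_ball_self one_pos
  refine ⟨⟨?_, by simp [extremalCQc], ?_⟩, ?_, fun z => -z, ?_, neg_zero, ?_, ?_⟩
  · exact DifferentiableOn.analyticOnNhd (fun z hz =>
      (hasDerivAt_extremalCQc hc₀ hc₁ hz).differentiableAt.differentiableWithinAt) isOpen_ball
  · rw [(hasDerivAt_extremalCQc hc₀ hc₁ h0).deriv]
    simp [innerSqrtIntegral]
  · intro z hz
    rw [(hasDerivAt_extremalCQc hc₀ hc₁ hz).deriv]
    exact Complex.exp_ne_zero _
  · exact analyticOnNhd_id.neg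
  · intro z hz
    simpa [unitDisk] using hz
  · intro z hz
    simp only [Function.comp_apply, mul_div_assoc, preSchwarzian_extremalCQc hc₀ hc₁ hz,
      mul_neg, ← sub_eq_add_neg]
    unfold sqrtIntegrand
    split_ifs with h
    · simp [h]
    · rw [mul_div_cancel₀ _ h]
      ring

theorem norm_sqrtIntegrand_le {c : ℝ} (hc₀ : 0 < c) (z : ℂ) :
    ‖sqrtIntegrand c z‖ ≤ c / (1 + √(1 - c * ‖z‖)) := by
  rw [sqrtIntegrand_eq, norm_div, norm_neg, Complex.norm_real, Real.norm_of_nonneg hc₀.le]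
  have hs := Real.sqrt_nonneg (1 - c * ‖z‖)
  refine div_le_div_of_nonneg_left hc₀.le (by linarith) (le_trans ?_ (Complex.re_le_norm _))
  rw [Complex.add_re, Complex.one_re, cpow_half_re]
  refine add_le_add_right (Real.sqrt_le_sqrt ?_) 1
  have h1 := norm_sub_norm_le (1:ℂ) ((c:ℂ) * z)
  have h2 : c * z.re ≤ c * ‖z‖ := mul_le_mul_of_nonneg_left (Complex.re_le_norm z) hc₀.le
  rw [norm_one, norm_mul, Complex.norm_real, Real.norm_of_nonneg hc₀.le] at h1
  simp only [Complex.sub_re, Complex.one_re, Complex.re_ofReal_mul]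
  linarith

theorem norm_sqrtIntegrand_ofReal {c r : ℝ} (hr : 0 < r) (hcr₀ : 0 ≤ c * r) (hcr : c * r ≤ 1) :
    ‖sqrtIntegrand c r‖ = (1 - √(1 - c * r)) / r := by
  have h1 : ((1 - (c:ℂ) * r) ^ ((1:ℂ)/2)) = (√(1 - c * r) : ℝ) := by
    rw [Real.sqrt_eq_rpow, Complex.ofReal_cpow (by linarith)]
    norm_num
  have h2 : √(1 - c * r) ≤ 1 := Real.sqrt_le_one.2 (by linarith)
  rw [sqrtIntegrand, if_neg (by exact_mod_cast hr.ne'), h1, ← Complex.ofReal_one,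
    ← Complex.ofReal_sub, norm_div, Complex.norm_real, Complex.norm_real,
    Real.norm_of_nonneg hr.le, Real.norm_of_nonpos (by linarith), neg_sub]

/-- In the variable `s = √(1 - c r)` the function `(1 - r²) c / (1 + √(1 - c r))` is largest at
its critical point `σ`. -/
theorem le_of_critical {c s σ : ℝ} (hc₀ : 0 < c) (hc₁ : c ≤ 1) (hs : 0 ≤ s) (hσ : 0 < σ)
    (hcrit : c ^ 2 = (1 - σ) * (1 + 3 * σ) * (1 + σ) ^ 2) :
    (1 - ((1 - s ^ 2) / c) ^ 2) * (c / (1 + s)) ≤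
      (1 - ((1 - σ ^ 2) / c) ^ 2) * (c / (1 + σ)) := by
  have hpoly : 4 + 2 * σ ≤ 4 * σ ^ 2 + 3 * σ ^ 3 := by
    have h : σ * (4 + 2 * σ - 4 * σ ^ 2 - 3 * σ ^ 3) ≤ 0 := by nlinarith
    nlinarith [nonpos_of_mul_nonpos_right h hσ]
  have hσ2 : 2 ≤ 3 * σ ^ 2 := by
    by_contra! h
    nlinarith [mul_pos hσ (sub_pos.2 h)]
  have hid : (1 - ((1 - σ ^ 2) / c) ^ 2) * (c / (1 + σ)) -
      (1 - ((1 - s ^ 2) / c) ^ 2) * (c / (1 + s)) =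
      (s - σ) ^ 2 * (s ^ 2 + 2 * σ * s + (3 * σ ^ 2 - 2)) / (c * (1 + s)) := by
    have h1 : 1 + s ≠ 0 := by positivity
    have h2 : 1 + σ ≠ 0 := by positivity
    field_simp
    linear_combination (s - σ) * hcrit
  have : 0 ≤ (s - σ) ^ 2 * (s ^ 2 + 2 * σ * s + (3 * σ ^ 2 - 2)) / (c * (1 + s)) := by
    have : 0 ≤ 3 * σ ^ 2 - 2 := by linarith
    positivity
  linarith

/-- Sharpness of the pre-Schwarzian norm estimate for C(q_c): the extremal function f₄
belongs to C(q_c) and its pre-Schwarzian norm equals the bound. -/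
theorem preSchwarzian_sharp_C_qc (c : ℝ) (hc₀ : 0 < c) (hc₁ : c ≤ 1)
    (α : ℝ) (hα : α ∈ Set.Ioo (0:ℝ) 1)
    (hroot : 2*(1 + α^2)*(1 - Real.sqrt (1 - c*α)) - c*(α + 3*α^3) = 0) :
    MemC (fun z => (1 + (c:ℂ) * z) ^ ((1:ℂ)/2)) (extremalCQc c) ∧
      IsLUB (pSVals (extremalCQc c))
        ((1 - α^2) * (1 - Real.sqrt (1 - c*α)) / α) := by
  refine ⟨memC_extremalCQc hc₀ hc₁, ?_⟩
  obtain ⟨hα₀, hα₁⟩ := hα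
  have hcα₀ : 0 < c * α := mul_pos hc₀ hα₀
  have hcα₁ : c * α < 1 := by nlinarith
  have hval := norm_sqrtIntegrand_ofReal hα₀ hcα₀.le hcα₁.le
  have hσ : 0 < √(1 - c * α) := Real.sqrt_pos.2 (by linarith)
  have hσ2 : √(1 - c * α) ^ 2 = 1 - c * α := Real.sq_sqrt (by linarith)
  set σ := √(1 - c * α)
  have hα_eq : α = (1 - σ ^ 2) / c := by
    rw [hσ2]
    field_simp
    ring
  have hσ1 : 1 - σ ≠ 0 := by
    intro h
    have : σ = 1 := by linarith
    rw [this] at hσ2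
    linarith
  have hcrit : c ^ 2 = (1 - σ) * (1 + 3 * σ) * (1 + σ) ^ 2 := by
    have h1 : 2 * (1 + α ^ 2) = (1 + σ) * (1 + 3 * α ^ 2) := by
      refine mul_left_cancel₀ hσ1 ?_
      linear_combination hroot + (1 + 3 * α ^ 2) * hσ2
    have h2 : c * α = 1 - σ ^ 2 := by linarith
    refine mul_left_cancel₀ hσ1 ?_
    linear_combination c ^ 2 * h1 + (1 + 3 * σ) * (c * α + 1 - σ ^ 2) * h2
  have hmax : (1 - α ^ 2) * (1 - σ) / α = (1 - ((1 - σ ^ 2) / c) ^ 2) * (c / (1 + σ)) := by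
    rw [← hα_eq, mul_div_assoc]
    congr 1
    rw [div_eq_div_iff hα₀.ne' (by positivity)]
    linear_combination -hσ2
  refine ⟨?_, fun b hb => hb ⟨(α : ℂ), ?_, ?_⟩⟩
  · rintro x ⟨z, hz, rfl⟩
    rw [preSchwarzian_extremalCQc hc₀ hc₁ hz, hmax]
    have hz1 : ‖z‖ < 1 := by simpa [unitDisk] using hz
    have hz0 := norm_nonneg z
    have hs2 : √(1 - c * ‖z‖) ^ 2 = 1 - c * ‖z‖ := Real.sq_sqrt (by nlinarith)
    have hz_eq : ‖z‖ = (1 - √(1 - c * ‖z‖) ^ 2) / c := by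
      rw [hs2]
      field_simp
      ring
    have hle := le_of_critical hc₀ hc₁ (Real.sqrt_nonneg (1 - c * ‖z‖)) hσ hcrit
    rw [← hz_eq] at hle
    exact (mul_le_mul_of_nonneg_left (norm_sqrtIntegrand_le hc₀ z) (by nlinarith)).trans hle
  · simpa [unitDisk, abs_of_pos hα₀] using hα₁
  · rw [preSchwarzian_extremalCQc hc₀ hc₁ (by simpa [unitDisk, abs_of_pos hα₀] using hα₁), hval,
      Complex.norm_real, Real.norm_of_nonneg hα₀.le, mul_div_assoc]
end
end
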